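/- Let G be a simple graph and let a₁, a₂, a₃, a₄ be four distinct pairwise non-adjacent vertices of G, each having exactly 3 neighbors, such that any two distinct vertices among a₁, a₂, a₃, a₄ have at most one common neighbor, and such that every other vertex of G has at most 2 neighbors in A = {a₁, a₂, a₃, a₄}. Call a vertex outside A 'type 1' if it has exactly one neighbor in A and 'type 2' if it has exactly two. Then it is impossible that simultaneously: exactly two neighbors of a₁ are type 1, exactly two neighbors of a₂ are type 1, and every neighbor of a₃ and every neighbor of a₄ is type 2. -/

import Mathlib

/-- Subcase "2, 2, 0, 0": let `a₁, a₂, a₃, a₄` be four distinct pairwise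
non-adjacent vertices of a simple graph, each of degree exactly 3, any two of
which have at most one common neighbor, and such that every other vertex has at
most 2 neighbors in `A = {a₁, a₂, a₃, a₄}`.  Calling a vertex outside `A`
"type 1" (resp. "type 2") if it has exactly one (resp. exactly two) neighbors in
`A`, it is impossible that simultaneously exactly two neighbors of `a₁` are
type 1, exactly two neighbors of `a₂` are type 1, and every neighbor of `a₃`
and of `a₄` is type 2. -/
theorem subcase_2200_impossible {V : Type*} [Fintype V] [DecidableEq V]
    (G : SimpleGraph V) [DecidableRel G.Adj] (a₁ a₂ a₃ a₄ : V)
    (hcard : ({a₁, a₂, a₃, a₄} : Finset V).card = 4)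
    (hnonadj : ∀ a ∈ ({a₁, a₂, a₃, a₄} : Finset V),
      ∀ b ∈ ({a₁, a₂, a₃, a₄} : Finset V), ¬ G.Adj a b)
    (hdeg : ∀ a ∈ ({a₁, a₂, a₃, a₄} : Finset V), G.degree a = 3)
    (hcommon : ∀ a ∈ ({a₁, a₂, a₃, a₄} : Finset V),
      ∀ b ∈ ({a₁, a₂, a₃, a₄} : Finset V), a ≠ b →
        (Finset.univ.filter (fun v => G.Adj a v ∧ G.Adj b v)).card ≤ 1)
    (htype : ∀ v, v ∉ ({a₁, a₂, a₃, a₄} : Finset V) →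
      (({a₁, a₂, a₃, a₄} : Finset V).filter (fun a => G.Adj v a)).card ≤ 2) :
    ¬ (((G.neighborFinset a₁).filter
          (fun v => (({a₁, a₂, a₃, a₄} : Finset V).filter
            (fun a => G.Adj v a)).card = 1)).card = 2 ∧
       ((G.neighborFinset a₂).filter
          (fun v => (({a₁, a₂, a₃, a₄} : Finset V).filter
            (fun a => G.Adj v a)).card = 1)).card = 2 ∧
       (∀ v ∈ G.neighborFinset a₃,
          (({a₁, a₂, a₃, a₄} : Finset V).filter (fun a => G.Adj v a)).card = 2) ∧
       (∀ v ∈ G.neighborFinset a₄,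
          (({a₁, a₂, a₃, a₄} : Finset V).filter (fun a => G.Adj v a)).card = 2)) := by
  rintro ⟨h1, -, h3, h4⟩
  have key : ∀ x y z w : V, ({a₁, a₂, a₃, a₄} : Finset V) = {x, y, z, w} →
      x ≠ y → x ≠ z → x ≠ w →
      (∀ v ∈ G.neighborFinset x,
        (({a₁, a₂, a₃, a₄} : Finset V).filter (fun a => G.Adj v a)).card = 2) →
      ∃ v, G.Adj x v ∧ G.Adj y v := by
    intro x y z w hS hxy hxz hxw h
    rw [hS] at hdeg hcommon h
    by_contra hne
    have hsub : G.neighborFinset x ⊆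
        Finset.univ.filter (fun v => G.Adj x v ∧ G.Adj z v) ∪
        Finset.univ.filter (fun v => G.Adj x v ∧ G.Adj w v) := by
      intro v hv
      have hc := h v hv
      rw [SimpleGraph.mem_neighborFinset] at hv
      obtain ⟨b, hb, hbx⟩ := Finset.exists_mem_ne (by rw [hc]; norm_num) x
      simp only [Finset.mem_filter, Finset.mem_insert, Finset.mem_singleton] at hb
      obtain ⟨hb, hvb⟩ := hb
      have hbv := hvb.symm
      simp only [Finset.mem_union, Finset.mem_filter, Finset.mem_univ, true_and]
      rcases hb with rfl | rfl | rfl | rfl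
      · exact absurd rfl hbx
      · exact absurd ⟨v, hv, hbv⟩ hne
      · exact Or.inl ⟨hv, hbv⟩
      · exact Or.inr ⟨hv, hbv⟩
    have e1 := Finset.card_le_card hsub
    have e2 := Finset.card_union_le
      (Finset.univ.filter (fun v => G.Adj x v ∧ G.Adj z v))
      (Finset.univ.filter (fun v => G.Adj x v ∧ G.Adj w v))
    have e3 := hcommon x (by simp) z (by simp) hxz
    have e4 := hcommon x (by simp) w (by simp) hxw
    have e5 := hdeg x (by simp)
    rw [SimpleGraph.card_neighborFinset_eq_degree] at e1
    omega
  have d : a₁ ≠ a₃ ∧ a₁ ≠ a₄ ∧ a₃ ≠ a₄ ∧ a₂ ≠ a₃ ∧ a₂ ≠ a₄ := by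
    refine ⟨?_, ?_, ?_, ?_, ?_⟩ <;> rintro rfl
    · have := Finset.card_le_three (a := a₁) (b := a₂) (c := a₄)
      have e : ({a₁, a₂, a₁, a₄} : Finset V) = {a₁, a₂, a₄} := by ext; simp; tauto
      rw [e] at hcard; omega
    · have := Finset.card_le_three (a := a₁) (b := a₂) (c := a₃)
      have e : ({a₁, a₂, a₃, a₁} : Finset V) = {a₁, a₂, a₃} := by ext; simp; tauto
      rw [e] at hcard; omega
    · have := Finset.card_le_three (a := a₁) (b := a₂) (c := a₃)
      have e : ({a₁, a₂, a₃, a₃} : Finset V) = {a₁, a₂, a₃} := by ext; simp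
      rw [e] at hcard; omega
    · have := Finset.card_le_three (a := a₁) (b := a₂) (c := a₄)
      have e : ({a₁, a₂, a₂, a₄} : Finset V) = {a₁, a₂, a₄} := by ext; simp
      rw [e] at hcard; omega
    · have := Finset.card_le_three (a := a₁) (b := a₂) (c := a₃)
      have e : ({a₁, a₂, a₃, a₂} : Finset V) = {a₁, a₂, a₃} := by ext; simp; tauto
      rw [e] at hcard; omega
  obtain ⟨d13, d14, d34, d23, d24⟩ := d
  obtain ⟨v, hv3, hv1⟩ := key a₃ a₁ a₂ a₄ (by ext; simp; tauto) d13.symm d23.symm d34 h3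
  obtain ⟨w, hw4, hw1⟩ := key a₄ a₁ a₂ a₃ (by ext; simp; tauto) d14.symm d24.symm d34.symm h4
  have cv := h3 v (by simpa using hv3)
  have cw := h4 w (by simpa using hw4)
  have hsum := Finset.card_filter_add_card_filter_not (s := G.neighborFinset a₁)
    (fun v => (({a₁, a₂, a₃, a₄} : Finset V).filter (fun a => G.Adj v a)).card = 1)
  rw [h1, SimpleGraph.card_neighborFinset_eq_degree, hdeg a₁ (by simp)] at hsum
  have hvw : v = w := by
    have hle : ((G.neighborFinset a₁).filter (fun v => ¬ (({a₁, a₂, a₃, a₄} : Finset V).filter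
        (fun a => G.Adj v a)).card = 1)).card ≤ 1 := by omega
    refine Finset.card_le_one.mp hle v ?_ w ?_
    · rw [Finset.mem_filter, cv]; simpa using hv1
    · rw [Finset.mem_filter, cw]; simpa using hw1
  subst hvw
  have hsub : ({a₁, a₃, a₄} : Finset V) ⊆
      ({a₁, a₂, a₃, a₄} : Finset V).filter (fun a => G.Adj v a) := by
    intro b hb
    simp only [Finset.mem_insert, Finset.mem_singleton] at hb
    rcases hb with rfl | rfl | rfl
    · simp [hv1.symm]
    · simp [hv3.symm]
    · simp [hw4.symm]
  have e1 := Finset.card_le_card hsub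
  rw [Finset.card_eq_three.mpr ⟨a₁, a₃, a₄, d13, d14, d34, rfl⟩] at e1
  omega
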